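/- Let n ∈ ℕ, σ > 0, and let X ⊆ ℝⁿ have non-empty interior. Let K(x,t) = exp(-‖x-t‖²/σ²) and let H_K be the RKHS of K on X. Then for every c ∈ ℝⁿ: (i) a function f : X → ℝ belongs to H_K if and only if f(x) = e^{-‖x-c‖²/σ²}·∑_{|α|=0}^∞ w_α (x-c)^α for real coefficients (w_α) with ∑_{k=0}^∞ (k!/(2/σ²)^k) ∑_{|α|=k} w_α²/C^k_α < ∞, in which case ‖f‖²_K equals this sum; (ii) the inner product of f (with coefficients (w_α)) and g (with coefficients (v_α)) in H_K is ⟨f,g⟩_K = ∑_{k=0}^∞ (k!/(2/σ²)^k) ∑_{|α|=k} w_α v_α / C^k_α; and (iii) the family {φ_{α,c}|_X}_{α ∈ (ℕ∪{0})ⁿ} is an orthonormal basis of H_K. -/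

import Mathlib

open scoped RealInnerProductSpace

/-- A Hilbert space of real-valued functions on `X`: a Hilbert space `carrier` together with an
injective linear realization of its elements as functions `X → ℝ` (so that the vector space
operations are pointwise). -/
structure HilbertFunSpace (X : Type*) where
  carrier : Type
  [ng : NormedAddCommGroup carrier]
  [ip : InnerProductSpace ℝ carrier]
  [cs : CompleteSpace carrier]
  toFun : carrier → X → ℝ
  add' : ∀ f g : carrier, toFun (f + g) = toFun f + toFun g
  smul' : ∀ (a : ℝ) (f : carrier), toFun (a • f) = a • toFun f
  inj' : Function.Injective toFun

attribute [instance] HilbertFunSpace.ng HilbertFunSpace.ip HilbertFunSpace.cs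

/-- `S` is a reproducing kernel Hilbert space with kernel `K`. -/
def HilbertFunSpace.IsRKHS {X : Type*} (S : HilbertFunSpace X) (K : X → X → ℝ) : Prop :=
  ∀ x : X, ∃ kx : S.carrier, S.toFun kx = (fun y => K x y) ∧
    ∀ f : S.carrier, ⟪f, kx⟫ = S.toFun f x

/-- The function `φ_{α,c}(x) = √((2/σ²)^k C^k_α / k!)·e^{-‖x-c‖²/σ²}·(x-c)^α` where `k = |α|`. -/
noncomputable def phiFn (n : ℕ) (σ : ℝ) (c : EuclideanSpace ℝ (Fin n)) (α : Fin n → ℕ)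
    (x : EuclideanSpace ℝ (Fin n)) : ℝ :=
  Real.sqrt ((2 / σ ^ 2) ^ (∑ i, α i) * (Nat.multinomial Finset.univ α : ℝ) /
      ((∑ i, α i).factorial : ℝ)) *
    Real.exp (-‖x - c‖ ^ 2 / σ ^ 2) * ∏ i, (x i - c i) ^ α i

theorem eq_zero_of_tsum_mul_pow_eq_zero (c : ℕ → ℝ) (hc : ∀ t : ℝ, Summable fun m => c m * t ^ m)
    {U : Set ℝ} (hU : IsOpen U) (hne : U.Nonempty) (h : ∀ t ∈ U, ∑' m, c m * t ^ m = 0) (m : ℕ) :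
    c m = 0 := by
  set p := FormalMultilinearSeries.ofScalars ℝ c with hp
  have hrad : p.radius = ⊤ := by
    refine ENNReal.eq_top_of_forall_nnreal_le fun r => p.le_radius_of_summable ?_
    have := (hc r).norm
    simpa [hp, FormalMultilinearSeries.ofScalars_norm] using this
  have hball : HasFPowerSeriesOnBall p.sum p 0 ⊤ := hrad ▸
    p.hasFPowerSeriesOnBall (by simp [hrad])
  have hsum : ∀ t, p.sum t = ∑' m, c m * t ^ m := fun t => by
    simp [hp, FormalMultilinearSeries.sum, mul_comm]
  obtain ⟨t₀, ht₀⟩ := hne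
  have hana : AnalyticOnNhd ℝ p.sum Set.univ := by
    have := hball.analyticOnNhd
    simpa using this
  have hzero : p.sum = 0 :=
    hana.eq_of_eventuallyEq (z₀ := t₀) (fun _ _ => analyticAt_const)
      (by
        filter_upwards [hU.mem_nhds ht₀] with t ht
        simpa [hsum] using h t ht)
  have hp0 : p = 0 := HasFPowerSeriesAt.eq_zero (hzero ▸ hball.hasFPowerSeriesAt)
  exact congrFun ((FormalMultilinearSeries.ofScalars_series_eq_zero ℝ).1 hp0) m

theorem eq_zero_of_tsum_mul_prod_pow_eq_zero {n : ℕ} (d : (Fin n → ℕ) → ℝ)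
    (hd : ∀ y : Fin n → ℝ, Summable fun α => d α * ∏ i, y i ^ α i) (U : Fin n → Set ℝ)
    (hU : ∀ i, IsOpen (U i)) (hne : ∀ i, (U i).Nonempty)
    (h : ∀ y : Fin n → ℝ, (∀ i, y i ∈ U i) → ∑' α, d α * ∏ i, y i ^ α i = 0) (α : Fin n → ℕ) :
    d α = 0 := by
  induction n with
  | zero =>
    have := h 0 (fun i => i.elim0)
    rw [tsum_fintype] at this
    rw [Fintype.sum_subsingleton _ α] at this
    simpa using this
  | succ n ih =>
    have hcons (y : Fin (n + 1) → ℝ) : Summable fun q : ℕ × (Fin n → ℕ) =>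
        d (Fin.cons q.1 q.2) * (y 0 ^ q.1 * ∏ i : Fin n, y i.succ ^ q.2 i) := by
      have := (Fin.consEquiv fun _ : Fin (n + 1) => ℕ).summable_iff.2 (hd y)
      simpa [Function.comp_def, Fin.prod_univ_succ, Fin.consEquiv] using this
    have htail (m : ℕ) (y : Fin n → ℝ) :
        Summable fun β : Fin n → ℕ => d (Fin.cons m β) * ∏ i, y i ^ β i := by
      simpa [Function.comp_def] using
        (hcons (Fin.cons 1 y)).comp_injective (Prod.mk_right_injective m)
    have hslice (y : Fin n → ℝ) (t : ℝ) :
        HasSum (fun m => (∑' β : Fin n → ℕ, d (Fin.cons m β) * ∏ i, y i ^ β i) * t ^ m)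
          (∑' α, d α * ∏ i, (Fin.cons t y : Fin (n + 1) → ℝ) i ^ α i) := by
      have h1 : HasSum _ _ := (Fin.consEquiv fun _ : Fin (n + 1) => ℕ).hasSum_iff.2
        (hd (Fin.cons t y)).hasSum
      refine h1.prod_fiberwise fun m => ?_
      convert! (htail m y).hasSum.mul_right (t ^ m) using 2 with β
      simp [Fin.prod_univ_succ, Fin.consEquiv]
      ring
    rw [← Fin.cons_self_tail α]
    refine ih (fun β => d (Fin.cons (α 0) β)) (htail _) (fun i => U i.succ) (fun i => hU _)
      (fun i => hne _) (fun y hy => ?_) _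
    refine eq_zero_of_tsum_mul_pow_eq_zero
      (fun m => ∑' β : Fin n → ℕ, d (Fin.cons m β) * ∏ i, y i ^ β i)
      (fun t => (hslice y t).summable) (hU 0) (hne 0) (fun t ht => ?_) (α 0)
    rw [(hslice y t).tsum_eq]
    exact h _ (Fin.cases ht hy)

theorem hasSum_mul_prod {ι κ : Type*} {f : ι → ℝ} {g : κ → ℝ} {a b : ℝ} (hf : HasSum f a)
    (hg : HasSum g b) : HasSum (fun q : ι × κ => f q.1 * g q.2) (a * b) := by
  have hf' := hf.summable.norm
  have hg' := hg.summable.norm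
  have h := summable_mul_of_summable_norm hf' hg'
  exact hf.mul hg h

theorem hasSum_prod_pi {n : ℕ} (f : Fin n → ℕ → ℝ) (a : Fin n → ℝ)
    (hf : ∀ i, HasSum (f i) (a i)) :
    HasSum (fun α : Fin n → ℕ => ∏ i, f i (α i)) (∏ i, a i) := by
  induction n with
  | zero => simp
  | succ n ih =>
    have h1 := ih (fun i => f i.succ) (fun i => a i.succ) (fun i => hf _)
    have h2 := hasSum_mul_prod (hf 0) h1
    refine (Fin.consEquiv fun _ : Fin (n + 1) => ℕ).hasSum_iff.1 ?_
    simpa [Function.comp_def, Fin.prod_univ_succ, Fin.consEquiv] using h2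

theorem denseRange_linearCombination_of_forall_inner_eq_zero {ι H : Type*} [NormedAddCommGroup H]
    [InnerProductSpace ℝ H] [CompleteSpace H] (w : ι → H)
    (hw : ∀ x, (∀ i, ⟪x, w i⟫ = 0) → x = 0) : DenseRange (Finsupp.linearCombination ℝ w) := by
  rw [DenseRange, ← LinearMap.coe_range, Submodule.dense_iff_topologicalClosure_eq_top,
    Submodule.topologicalClosure_eq_top_iff, Finsupp.range_linearCombination,
    Submodule.eq_bot_iff]
  intro x hx
  exact hw x fun i => (Submodule.mem_orthogonal' _ _).1 hx _
    (Submodule.subset_span (Set.mem_range_self i))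

theorem exists_linearIsometryEquiv_of_inner_eq {ι H₁ H₂ : Type*} [NormedAddCommGroup H₁]
    [InnerProductSpace ℝ H₁] [CompleteSpace H₁] [NormedAddCommGroup H₂] [InnerProductSpace ℝ H₂]
    [CompleteSpace H₂] (u : ι → H₁) (v : ι → H₂) (huv : ∀ i j, ⟪u i, u j⟫ = ⟪v i, v j⟫)
    (hu : ∀ x, (∀ i, ⟪x, u i⟫ = 0) → x = 0) (hv : ∀ x, (∀ i, ⟪x, v i⟫ = 0) → x = 0) :
    ∃ T : H₁ ≃ₗᵢ[ℝ] H₂, ∀ i, T (u i) = v i := by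
  have hnorm (x : ι →₀ ℝ) :
      ‖Finsupp.linearCombination ℝ v x‖ = ‖Finsupp.linearCombination ℝ u x‖ := by
    rw [← sq_eq_sq₀ (norm_nonneg _) (norm_nonneg _), ← real_inner_self_eq_norm_sq,
      ← real_inner_self_eq_norm_sq]
    simp only [Finsupp.linearCombination_apply, Finsupp.sum_inner, Finsupp.inner_sum,
      inner_smul_left, inner_smul_right, huv]
  have hdu := denseRange_linearCombination_of_forall_inner_eq_zero u hu
  have hdv := denseRange_linearCombination_of_forall_inner_eq_zero v hv
  refine ⟨(LinearEquiv.refl ℝ (ι →₀ ℝ)).extendOfIsometry _ _ hdu hdv hnorm, fun i => ?_⟩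
  simpa using LinearEquiv.extendOfIsometry_eq (LinearEquiv.refl ℝ (ι →₀ ℝ)) _ _ hdu hdv hnorm
    (Finsupp.single i 1)

/-- The squared normalising constant `(2/σ²)^k C^k_α / k!` of `phiFn`, where `k = |α|`. -/
noncomputable def gaussCoeff {n : ℕ} (σ : ℝ) (α : Fin n → ℕ) : ℝ :=
  (2 / σ ^ 2) ^ (∑ i, α i) * (Nat.multinomial Finset.univ α : ℝ) / ((∑ i, α i).factorial : ℝ)

theorem gaussCoeff_pos {n : ℕ} {σ : ℝ} (hσ : 0 < σ) (α : Fin n → ℕ) : 0 < gaussCoeff σ α := by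
  have := Nat.multinomial_pos Finset.univ α
  unfold gaussCoeff
  positivity

theorem gaussCoeff_eq_prod {n : ℕ} (σ : ℝ) (α : Fin n → ℕ) :
    gaussCoeff σ α = ∏ i, (2 / σ ^ 2) ^ α i / ((α i).factorial : ℝ) := by
  have h : (∏ i, ((α i).factorial : ℝ)) * (Nat.multinomial Finset.univ α : ℝ) =
      ((∑ i, α i).factorial : ℝ) := by
    exact_mod_cast Nat.multinomial_spec Finset.univ α
  have h0 : (∏ i, ((α i).factorial : ℝ)) ≠ 0 :=
    Finset.prod_ne_zero_iff.2 fun i _ => by positivity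
  have h1 : ((∑ i, α i).factorial : ℝ) ≠ 0 := by positivity
  rw [gaussCoeff, Finset.prod_div_distrib, Finset.prod_pow_eq_pow_sum, div_eq_div_iff h1 h0, ← h]
  ring

theorem hasSum_gaussCoeff_mul_prod_pow {n : ℕ} (σ : ℝ) (y : Fin n → ℝ) :
    HasSum (fun α : Fin n → ℕ => gaussCoeff σ α * ∏ i, y i ^ α i)
      (Real.exp (2 / σ ^ 2 * ∑ i, y i)) := by
  have := hasSum_prod_pi (fun i m => (2 / σ ^ 2 * y i) ^ m / (m.factorial : ℝ))
    (fun i => Real.exp (2 / σ ^ 2 * y i)) (fun i => by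
      rw [Real.exp_eq_exp_ℝ]
      exact NormedSpace.expSeries_div_hasSum_exp _)
  rw [Finset.mul_sum, Real.exp_sum]
  convert! this using 2 with α
  rw [gaussCoeff_eq_prod, ← Finset.prod_mul_distrib]
  exact Finset.prod_congr rfl fun i _ => by rw [mul_pow]; ring

theorem phiFn_eq {n : ℕ} (σ : ℝ) (c x : EuclideanSpace ℝ (Fin n)) (α : Fin n → ℕ) :
    phiFn n σ c α x = √(gaussCoeff σ α) * Real.exp (-‖x - c‖ ^ 2 / σ ^ 2) *
      ∏ i, (x i - c i) ^ α i :=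
  rfl

theorem hasSum_phiFn_mul_phiFn {n : ℕ} {σ : ℝ} (hσ : 0 < σ) (c x t : EuclideanSpace ℝ (Fin n)) :
    HasSum (fun α : Fin n → ℕ => phiFn n σ c α x * phiFn n σ c α t)
      (Real.exp (-‖x - t‖ ^ 2 / σ ^ 2)) := by
  have h := (hasSum_gaussCoeff_mul_prod_pow σ fun i => (x i - c i) * (t i - c i)).mul_left
    (Real.exp (-‖x - c‖ ^ 2 / σ ^ 2) * Real.exp (-‖t - c‖ ^ 2 / σ ^ 2))
  convert! h using 1
  · ext α
    simp only [phiFn_eq, mul_pow, Finset.prod_mul_distrib]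
    linear_combination (Real.exp (-‖x - c‖ ^ 2 / σ ^ 2) * Real.exp (-‖t - c‖ ^ 2 / σ ^ 2) *
      (∏ i, (x i - c i) ^ α i) * ∏ i, (t i - c i) ^ α i) *
      Real.mul_self_sqrt (gaussCoeff_pos hσ α).le
  · have hnorm : ‖x - t‖ ^ 2 = ‖x - c‖ ^ 2 + ‖t - c‖ ^ 2 -
        2 * ∑ i, (x i - c i) * (t i - c i) := by
      simp only [EuclideanSpace.real_norm_sq_eq, Finset.mul_sum, ← Finset.sum_add_distrib,
        ← Finset.sum_sub_distrib, PiLp.sub_apply]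
      exact Finset.sum_congr rfl fun i _ => by ring
    rw [← Real.exp_add, ← Real.exp_add, hnorm]
    congr 1
    ring

/-- The feature map `x ↦ (φ_{α,c}(x))_α` of the Gaussian kernel, with values in `ℓ²`. -/
noncomputable def gaussFeature {n : ℕ} {σ : ℝ} (hσ : 0 < σ) (c x : EuclideanSpace ℝ (Fin n)) :
    lp (fun _ : Fin n → ℕ => ℝ) 2 :=
  ⟨fun α => phiFn n σ c α x, memℓp_gen (by
    simpa [sq] using (hasSum_phiFn_mul_phiFn hσ c x x).summable)⟩

theorem hasSum_mul_phiFn {n : ℕ} {σ : ℝ} (hσ : 0 < σ) (c x : EuclideanSpace ℝ (Fin n))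
    (f : lp (fun _ : Fin n → ℕ => ℝ) 2) :
    HasSum (fun α => f α * phiFn n σ c α x) ⟪f, gaussFeature hσ c x⟫ := by
  simpa [gaussFeature, mul_comm] using lp.hasSum_inner (𝕜 := ℝ) f (gaussFeature hσ c x)

theorem inner_gaussFeature {n : ℕ} {σ : ℝ} (hσ : 0 < σ) (c x t : EuclideanSpace ℝ (Fin n)) :
    ⟪gaussFeature hσ c x, gaussFeature hσ c t⟫ = Real.exp (-‖x - t‖ ^ 2 / σ ^ 2) :=
  (hasSum_mul_phiFn hσ c t _).unique (hasSum_phiFn_mul_phiFn hσ c x t)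

theorem eq_zero_of_inner_gaussFeature_eq_zero {n : ℕ} {σ : ℝ} (hσ : 0 < σ)
    (c : EuclideanSpace ℝ (Fin n)) {X : Set (EuclideanSpace ℝ (Fin n))}
    (hX : (interior X).Nonempty) (f : lp (fun _ : Fin n → ℕ => ℝ) 2)
    (hf : ∀ x : X, ⟪f, gaussFeature hσ c x⟫ = 0) : f = 0 := by
  let shift : (Fin n → ℝ) → EuclideanSpace ℝ (Fin n) := fun y => WithLp.toLp 2 y + c
  have hshift : Continuous shift := by fun_prop
  have key (y : Fin n → ℝ) : HasSum (fun α => f α * √(gaussCoeff σ α) * ∏ i, y i ^ α i)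
      ((Real.exp (-‖shift y - c‖ ^ 2 / σ ^ 2))⁻¹ * ⟪f, gaussFeature hσ c (shift y)⟫) := by
    convert! (hasSum_mul_phiFn hσ c (shift y) f).mul_left
      (Real.exp (-‖shift y - c‖ ^ 2 / σ ^ 2))⁻¹ using 2 with α
    have hy (i : Fin n) : shift y i - c i = y i := by simp [shift]
    simp only [phiFn_eq, hy]
    field_simp
  obtain ⟨x₀, hx₀⟩ := hX
  obtain ⟨U, hU, hUX⟩ := isOpen_pi_iff'.1 (isOpen_interior.preimage hshift)
    (WithLp.ofLp (x₀ - c)) (by simpa [shift] using hx₀)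
  ext α
  have h0 := eq_zero_of_tsum_mul_prod_pow_eq_zero (fun α => f α * √(gaussCoeff σ α))
    (fun y => (key y).summable) U (fun i => (hU i).1) (fun i => ⟨_, (hU i).2⟩)
    (fun y hy => by
      have hyX : shift y ∈ X := interior_subset (hUX fun i _ => hy i)
      rw [(key y).tsum_eq, hf ⟨shift y, hyX⟩, mul_zero]) α
  simpa [(Real.sqrt_pos.2 (gaussCoeff_pos hσ α)).ne'] using h0

theorem weighted_mul_eq {n : ℕ} {σ : ℝ} (hσ : 0 < σ) (w v : ℝ) (α : Fin n → ℕ) :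
    ((∑ i, α i).factorial : ℝ) / (2 / σ ^ 2) ^ (∑ i, α i) * (w * v) /
      (Nat.multinomial Finset.univ α : ℝ) = w / √(gaussCoeff σ α) * (v / √(gaussCoeff σ α)) := by
  rw [div_mul_div_comm, Real.mul_self_sqrt (gaussCoeff_pos hσ α).le, gaussCoeff]
  have := (Nat.multinomial_pos Finset.univ α).ne'
  field_simp

theorem HilbertFunSpace.exists_gaussian_hilbertBasis {n : ℕ} {σ : ℝ} (hσ : 0 < σ)
    {X : Set (EuclideanSpace ℝ (Fin n))} (hX : (interior X).Nonempty) (S : HilbertFunSpace X)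
    (hS : S.IsRKHS (fun x t : X =>
      Real.exp (-‖(x : EuclideanSpace ℝ (Fin n)) - (t : EuclideanSpace ℝ (Fin n))‖ ^ 2 / σ ^ 2)))
    (c : EuclideanSpace ℝ (Fin n)) :
    ∃ b : HilbertBasis (Fin n → ℕ) ℝ S.carrier, ∀ f (x : X),
      HasSum (fun α => f α * phiFn n σ c α x) (S.toFun (b.repr.symm f) x) := by
  choose k hk hrep using hS
  have hzero : S.toFun 0 = 0 := by simpa using S.smul' 0 0
  obtain ⟨T, hT⟩ := exists_linearIsometryEquiv_of_inner_eq (fun x : X => gaussFeature hσ c x) k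
    (fun x t => by rw [inner_gaussFeature, hrep, hk])
    (eq_zero_of_inner_gaussFeature_eq_zero hσ c hX)
    (fun g hg => S.inj' (by
      rw [hzero]
      funext x
      rw [← hrep, hg, Pi.zero_apply]))
  refine ⟨⟨T.symm⟩, fun f x => ?_⟩
  rw [LinearIsometryEquiv.symm_symm, ← hrep, ← hT, LinearIsometryEquiv.inner_map_map]
  exact hasSum_mul_phiFn hσ c x f

/-- description of the Gaussian RKHS `H_K` on a set `X ⊆ ℝⁿ` with non-empty
interior, for every centre `c ∈ ℝⁿ`: (i) `f ∈ H_K` iff `f(x) = e^{-‖x-c‖²/σ²} ∑_α w_α (x-c)^α`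
with `∑_k (k!/(2/σ²)^k) ∑_{|α|=k} w_α²/C^k_α < ∞`, in which case `‖f‖²` equals this sum;
(ii) `⟨f,g⟩_K = ∑_k (k!/(2/σ²)^k) ∑_{|α|=k} w_α v_α /C^k_α`; (iii) `{φ_{α,c}|_X}_α` is an
orthonormal basis of `H_K`. -/
theorem gaussian_rkhs_description (n : ℕ) (σ : ℝ) (hσ : 0 < σ)
    (X : Set (EuclideanSpace ℝ (Fin n))) (hX : (interior X).Nonempty)
    (S : HilbertFunSpace X)
    (hS : S.IsRKHS (fun x t : X =>
      Real.exp (-‖(x : EuclideanSpace ℝ (Fin n)) - (t : EuclideanSpace ℝ (Fin n))‖ ^ 2 / σ ^ 2)))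
    (c : EuclideanSpace ℝ (Fin n)) :
    (∀ g : S.carrier, ∃ w : (Fin n → ℕ) → ℝ,
        (Summable fun α : Fin n → ℕ =>
          ((∑ i, α i).factorial : ℝ) / (2 / σ ^ 2) ^ (∑ i, α i) * w α ^ 2 /
            (Nat.multinomial Finset.univ α : ℝ)) ∧
        (∀ x : X, S.toFun g x =
          Real.exp (-‖(x : EuclideanSpace ℝ (Fin n)) - c‖ ^ 2 / σ ^ 2) *
            ∑' α : Fin n → ℕ, w α * ∏ i, ((x : EuclideanSpace ℝ (Fin n)) i - c i) ^ α i) ∧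
        ‖g‖ ^ 2 = ∑' α : Fin n → ℕ,
          ((∑ i, α i).factorial : ℝ) / (2 / σ ^ 2) ^ (∑ i, α i) * w α ^ 2 /
            (Nat.multinomial Finset.univ α : ℝ)) ∧
    (∀ w : (Fin n → ℕ) → ℝ,
        (Summable fun α : Fin n → ℕ =>
          ((∑ i, α i).factorial : ℝ) / (2 / σ ^ 2) ^ (∑ i, α i) * w α ^ 2 /
            (Nat.multinomial Finset.univ α : ℝ)) →
        ∃ g : S.carrier,
          (∀ x : X, S.toFun g x =
            Real.exp (-‖(x : EuclideanSpace ℝ (Fin n)) - c‖ ^ 2 / σ ^ 2) *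
              ∑' α : Fin n → ℕ, w α * ∏ i, ((x : EuclideanSpace ℝ (Fin n)) i - c i) ^ α i) ∧
          ‖g‖ ^ 2 = ∑' α : Fin n → ℕ,
            ((∑ i, α i).factorial : ℝ) / (2 / σ ^ 2) ^ (∑ i, α i) * w α ^ 2 /
              (Nat.multinomial Finset.univ α : ℝ)) ∧
    (∀ (w v : (Fin n → ℕ) → ℝ) (F G : S.carrier),
        (Summable fun α : Fin n → ℕ =>
          ((∑ i, α i).factorial : ℝ) / (2 / σ ^ 2) ^ (∑ i, α i) * w α ^ 2 /
            (Nat.multinomial Finset.univ α : ℝ)) →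
        (Summable fun α : Fin n → ℕ =>
          ((∑ i, α i).factorial : ℝ) / (2 / σ ^ 2) ^ (∑ i, α i) * v α ^ 2 /
            (Nat.multinomial Finset.univ α : ℝ)) →
        (∀ x : X, S.toFun F x =
          Real.exp (-‖(x : EuclideanSpace ℝ (Fin n)) - c‖ ^ 2 / σ ^ 2) *
            ∑' α : Fin n → ℕ, w α * ∏ i, ((x : EuclideanSpace ℝ (Fin n)) i - c i) ^ α i) →
        (∀ x : X, S.toFun G x =
          Real.exp (-‖(x : EuclideanSpace ℝ (Fin n)) - c‖ ^ 2 / σ ^ 2) *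
            ∑' α : Fin n → ℕ, v α * ∏ i, ((x : EuclideanSpace ℝ (Fin n)) i - c i) ^ α i) →
        ⟪F, G⟫ = ∑' α : Fin n → ℕ,
          ((∑ i, α i).factorial : ℝ) / (2 / σ ^ 2) ^ (∑ i, α i) * (w α * v α) /
            (Nat.multinomial Finset.univ α : ℝ)) ∧
    (∃ b : (Fin n → ℕ) → S.carrier,
        (∀ α : Fin n → ℕ, S.toFun (b α) = fun x : X => phiFn n σ c α x) ∧
        Orthonormal ℝ b ∧
        (Submodule.span ℝ (Set.range b)).topologicalClosure = ⊤) := by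
  obtain ⟨b, hb⟩ := S.exists_gaussian_hilbertBasis hσ hX hS c
  have hsq (w : ℝ) (α : Fin n → ℕ) : ((∑ i, α i).factorial : ℝ) / (2 / σ ^ 2) ^ (∑ i, α i) *
      w ^ 2 / (Nat.multinomial Finset.univ α : ℝ) = (w / √(gaussCoeff σ α)) ^ 2 := by
    rw [sq w, weighted_mul_eq hσ, sq]
  have hpos (α : Fin n → ℕ) : √(gaussCoeff σ α) ≠ 0 :=
    (Real.sqrt_pos.2 (gaussCoeff_pos hσ α)).ne'
  have hexp (f : lp (fun _ : Fin n → ℕ => ℝ) 2) (w : (Fin n → ℕ) → ℝ)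
      (hfw : ∀ α, f α = w α / √(gaussCoeff σ α)) (x : X) : S.toFun (b.repr.symm f) x =
      Real.exp (-‖(x : EuclideanSpace ℝ (Fin n)) - c‖ ^ 2 / σ ^ 2) *
        ∑' α : Fin n → ℕ, w α * ∏ i, ((x : EuclideanSpace ℝ (Fin n)) i - c i) ^ α i := by
    rw [← (hb f x).tsum_eq, ← tsum_mul_left]
    refine tsum_congr fun α => ?_
    have := hpos α
    rw [hfw, phiFn_eq]
    field_simp
  have hinner (f g : lp (fun _ : Fin n → ℕ => ℝ) 2) : HasSum (fun α => f α * g α)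
      ⟪b.repr.symm f, b.repr.symm g⟫ := by
    rw [LinearIsometryEquiv.inner_map_map]
    simpa [mul_comm] using lp.hasSum_inner (𝕜 := ℝ) f g
  have hnorm (f : lp (fun _ : Fin n → ℕ => ℝ) 2) : HasSum (fun α => f α ^ 2)
      (‖b.repr.symm f‖ ^ 2) := by
    rw [← real_inner_self_eq_norm_sq]
    simpa only [sq] using hinner f f
  have hex (w : (Fin n → ℕ) → ℝ) (hw : Summable fun α => (w α / √(gaussCoeff σ α)) ^ 2) :
      ∃ f : lp (fun _ : Fin n → ℕ => ℝ) 2, ∀ α, f α = w α / √(gaussCoeff σ α) :=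
    ⟨⟨fun α => w α / √(gaussCoeff σ α), memℓp_gen (by simpa [div_pow] using hw)⟩, fun _ => rfl⟩
  simp only [hsq, weighted_mul_eq hσ]
  refine ⟨fun g => ?_, fun w hw => ?_, fun w v F G hw hv hF hG => ?_, b, fun α => ?_,
    b.orthonormal, b.dense_span⟩
  · have hfw (α : Fin n → ℕ) : b.repr g α =
        b.repr g α * √(gaussCoeff σ α) / √(gaussCoeff σ α) :=
      (mul_div_cancel_right₀ _ (hpos α)).symm
    have hg := hnorm (b.repr g)
    rw [b.repr.symm_apply_apply] at hg
    refine ⟨fun α => b.repr g α * √(gaussCoeff σ α), ?_, fun x => ?_, ?_⟩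
    · simpa only [← hfw] using hg.summable
    · simpa using hexp (b.repr g) _ hfw x
    · simpa only [← hfw] using hg.tsum_eq.symm
  · obtain ⟨f, hf⟩ := hex w hw
    refine ⟨b.repr.symm f, hexp f w hf, ?_⟩
    simpa only [hf] using (hnorm f).tsum_eq.symm
  · obtain ⟨f, hf⟩ := hex w hw
    obtain ⟨g, hg⟩ := hex v hv
    obtain rfl : b.repr.symm f = F := S.inj' (funext fun x => by rw [hexp f w hf, hF])
    obtain rfl : b.repr.symm g = G := S.inj' (funext fun x => by rw [hexp g v hg, hG])
    simpa only [hf, hg] using (hinner f g).tsum_eq.symm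
  · classical
    funext x
    rw [← b.repr_symm_single]
    refine (hb _ x).unique ?_
    convert! hasSum_ite_eq α (phiFn n σ c α x) using 2 with β
    by_cases h : β = α
    · subst h; simp
    · simp [h]
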